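/- Let f(x) = (1/720) x^{6} e^{−x} 1_{{x>0}} be the density of the Gamma distribution Γ(7,1), let r = 2, s = 1, and θ* = (s+7)/(r+7) = 8/9. Setting C_{f,t} = ∫_0^∞ f(x)^{1/(1+t)} dx for t > 0, the empirical-measure identity fails at u = 1: (1/(C_{f,2} θ*)) ∫_0^1 f(x/θ*)^{1/3} dx ≠ (1/C_{f,1}) ∫_0^1 f(x)^{1/2} dx; equivalently, (185/128) e^{−3/8} − (79/48) e^{−1/2} ≠ −511/512. Consequently, the dilated sequence (θ*·α_n)_{n≥1} of an asymptotically L^2-optimal sequence of quantizers for Γ(7,1) does not satisfy the L^1 empirical measure theorem, i.e. (1/n)·card(θ*·α_n ∩ [0,u]) does not converge to (1/C_{f,1}) ∫_0^u f(x)^{1/2} dx for every u ≥ 0. -/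

import Mathlib

open MeasureTheory ENNReal Filter Set Metric Topology
open scoped Classical

noncomputable section

/-- Distance from a point `x ∈ ℝ` to a finite codebook `α`. -/
def qdist1 (x : ℝ) (α : Finset ℝ) : ℝ := Metric.infDist x (α : Set ℝ)

/-- The `r`-th power `L^r` quantization error `∫ d(x,α)^r dP` of a codebook `α`. -/
def qerr1 (P : Measure ℝ) (r : ℝ) (α : Finset ℝ) : ℝ≥0∞ :=
  ∫⁻ x, ENNReal.ofReal (qdist1 x α) ^ r ∂P

/-- The optimal `n`-level `L^r` quantization error `e_{n,r}(P)`. -/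
def enr1 (P : Measure ℝ) (r : ℝ) (n : ℕ) : ℝ≥0∞ :=
  ⨅ (α : Finset ℝ) (_ : α.Nonempty) (_ : α.card ≤ n), qerr1 P r α ^ (1 / r)

/-- The constant `J_{r,1} = inf_{n ≥ 1} n^r e_{n,r}(U([0,1]))^r`. -/
def J1 (r : ℝ) : ℝ≥0∞ :=
  ⨅ (n : ℕ) (_ : 1 ≤ n), (n : ℝ≥0∞) ^ r * enr1 (volume.restrict (Icc (0 : ℝ) 1)) r n ^ r

/-- Zador's constant `Q_r(P)` on `ℝ` for `P = f·λ_1`. -/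
def Q1 (f : ℝ → ℝ) (r : ℝ) : ℝ≥0∞ :=
  J1 r * (∫⁻ x, ENNReal.ofReal (f x) ^ (1 / (1 + r))) ^ (1 + r : ℝ)

/-- The scaled codebook `θ·α = {θa : a ∈ α}`. -/
def scaleCB (θ : ℝ) (α : Finset ℝ) : Finset ℝ := α.image fun a => θ * a

/-- An `L^r(P)`-optimal sequence of `n`-quantizers on `ℝ`. -/
def OptimalSeq1 (P : Measure ℝ) (r : ℝ) (α : ℕ → Finset ℝ) : Prop :=
  ∀ n, 1 ≤ n → (α n).Nonempty ∧ (α n).card ≤ n ∧ qerr1 P r (α n) = enr1 P r n ^ r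

/-- An asymptotically `L^r(P)`-optimal sequence of quantizers on `ℝ`, `P = f·λ_1`. -/
def AsympOptimalSeq1 (P : Measure ℝ) (f : ℝ → ℝ) (r : ℝ) (α : ℕ → Finset ℝ) : Prop :=
  (∀ n, 1 ≤ n → (α n).Nonempty ∧ (α n).card ≤ n) ∧
  Tendsto (fun n : ℕ => (n : ℝ≥0∞) ^ r * qerr1 P r (α n)) atTop (𝓝 (Q1 f r))

/-- `L^s(P)`-rate-optimality of a sequence of codebooks on `ℝ`. -/
def RateOptimal1 (P : Measure ℝ) (s : ℝ) (β : ℕ → Finset ℝ) : Prop :=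
  limsup (fun n : ℕ => (n : ℝ≥0∞) ^ s * qerr1 P s (β n)) atTop < ⊤

/-- The density of the Gamma distribution `Γ(7,1)`: `f(x) = x^6 e^{-x}/720` on `(0,∞)`. -/
def gamma71Density (x : ℝ) : ℝ := if 0 < x then (1 / 720) * x ^ 6 * Real.exp (-x) else 0

/-- `C_{f,t} = ∫_0^∞ f(x)^{1/(1+t)} dx` for the `Γ(7,1)` density `f`. -/
def Cft (t : ℝ) : ℝ := ∫ x in Ioi (0 : ℝ), gamma71Density x ^ (1 / (1 + t))

lemma integral_max_sq_sub_le {a b σ : ℝ} (y : ℝ) (hσ : 0 ≤ σ) (hab : a ≤ b) :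
    ∫ x in a..b, max (σ ^ 2 - (x - y) ^ 2) 0 ≤ 4 / 3 * σ ^ 3 := by
  have hind : (fun x : ℝ => max (σ ^ 2 - (x - y) ^ 2) 0) =
      (Icc (y - σ) (y + σ)).indicator fun x => σ ^ 2 - (x - y) ^ 2 := by
    funext x
    by_cases hx : x ∈ Icc (y - σ) (y + σ)
    · rw [indicator_of_mem hx, max_eq_left]
      nlinarith [hx.1, hx.2]
    · rw [indicator_of_notMem hx, max_eq_right]
      have : σ ≤ |x - y| := by
        by_contra! h
        exact hx ⟨by linarith [(abs_lt.1 h).1], by linarith [(abs_lt.1 h).2]⟩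
      nlinarith [sq_abs (x - y)]
  have hint : IntegrableOn (fun x : ℝ => σ ^ 2 - (x - y) ^ 2) (Icc (y - σ) (y + σ)) :=
    (by fun_prop : Continuous fun x : ℝ => σ ^ 2 - (x - y) ^ 2).integrableOn_Icc
  have hint' : Integrable (fun x : ℝ => max (σ ^ 2 - (x - y) ^ 2) 0) := by
    rw [hind]; exact hint.integrable_indicator measurableSet_Icc
  calc ∫ x in a..b, max (σ ^ 2 - (x - y) ^ 2) 0
      ≤ ∫ x : ℝ, max (σ ^ 2 - (x - y) ^ 2) 0 := by
        rw [intervalIntegral.integral_of_le hab]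
        exact setIntegral_le_integral hint' (ae_of_all _ fun x => le_max_right _ _)
    _ = ∫ x in (y - σ)..(y + σ), (σ ^ 2 - (x - y) ^ 2) := by
        rw [hind, integral_indicator measurableSet_Icc, integral_Icc_eq_integral_Ioc,
          intervalIntegral.integral_of_le (by linarith)]
    _ = ∫ x in (-σ)..σ, (σ ^ 2 - x ^ 2) := by
        rw [intervalIntegral.integral_comp_sub_right (fun x => σ ^ 2 - x ^ 2) y]
        congr 1 <;> ring
    _ = 4 / 3 * σ ^ 3 := by
        rw [intervalIntegral.integral_sub (by simp) (by simp)]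
        simp only [intervalIntegral.integral_const, integral_pow, smul_eq_mul]
        norm_num
        ring

lemma sub_sum_max_le_infDist_sq {α : Finset ℝ} (hα : α.Nonempty) {a b x : ℝ} (σ : ℝ)
    (hx : x ∈ Icc a b) :
    σ ^ 2 - ∑ y ∈ insert a (insert b (α.filter (· ∈ Ioo a b))), max (σ ^ 2 - (x - y) ^ 2) 0 ≤
      infDist x (α : Set ℝ) ^ 2 := by
  obtain ⟨y₀, hy₀, hd⟩ :=
    α.finite_toSet.isCompact.exists_infDist_eq_dist (by exact_mod_cast hα) x
  rw [hd, Real.dist_eq, sq_abs]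
  set S := insert a (insert b (α.filter (· ∈ Ioo a b))) with hS
  obtain ⟨y, hy, hle⟩ : ∃ y ∈ S, (x - y) ^ 2 ≤ (x - y₀) ^ 2 := by
    rcases le_or_gt y₀ a with h | h
    · exact ⟨a, by simp [hS], by nlinarith [hx.1]⟩
    rcases le_or_gt b y₀ with h' | h'
    · exact ⟨b, by simp [hS], by nlinarith [hx.2]⟩
    · exact ⟨y₀, by simp [hS, h, h', Finset.mem_coe.1 hy₀], le_rfl⟩
  have := Finset.single_le_sum (f := fun y => max (σ ^ 2 - (x - y) ^ 2) 0)
    (fun i _ => le_max_right _ _) hy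
  have := le_max_left (σ ^ 2 - (x - y) ^ 2) 0
  linarith

lemma le_integral_infDist_sq {α : Finset ℝ} (hα : α.Nonempty) {a b σ : ℝ} (hσ : 0 ≤ σ)
    (hab : a ≤ b) :
    σ ^ 2 * (b - a) - 4 / 3 * σ ^ 3 * ((α.filter (· ∈ Ioo a b)).card + 2) ≤
      ∫ x in a..b, infDist x (α : Set ℝ) ^ 2 := by
  set S := insert a (insert b (α.filter (· ∈ Ioo a b))) with hS
  have hcard : (S.card : ℝ) ≤ (α.filter (· ∈ Ioo a b)).card + 2 := by
    have h : S.card ≤ (α.filter (· ∈ Ioo a b)).card + 2 :=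
      (Finset.card_insert_le _ _).trans (Nat.succ_le_succ (Finset.card_insert_le _ _))
    exact_mod_cast h
  have hbump (y : ℝ) : Continuous fun x : ℝ => max (σ ^ 2 - (x - y) ^ 2) 0 := by fun_prop
  have hcont : Continuous fun x : ℝ => infDist x (α : Set ℝ) ^ 2 :=
    (continuous_infDist_pt _).pow 2
  calc σ ^ 2 * (b - a) - 4 / 3 * σ ^ 3 * ((α.filter (· ∈ Ioo a b)).card + 2)
      ≤ σ ^ 2 * (b - a) - 4 / 3 * σ ^ 3 * S.card := by gcongr
    _ ≤ σ ^ 2 * (b - a) - ∑ y ∈ S, ∫ x in a..b, max (σ ^ 2 - (x - y) ^ 2) 0 := by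
        gcongr
        calc _ ≤ ∑ y ∈ S, 4 / 3 * σ ^ 3 :=
              Finset.sum_le_sum fun y _ => integral_max_sq_sub_le y hσ hab
          _ = _ := by rw [Finset.sum_const, nsmul_eq_mul]; ring
    _ = ∫ x in a..b, (σ ^ 2 - ∑ y ∈ S, max (σ ^ 2 - (x - y) ^ 2) 0) := by
        rw [intervalIntegral.integral_sub (by simp)
          ((continuous_finsetSum _ fun y _ => hbump y).intervalIntegrable _ _),
          intervalIntegral.integral_finsetSum fun y _ => (hbump y).intervalIntegrable _ _]
        simp [mul_comm]
    _ ≤ _ := by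
        refine intervalIntegral.integral_mono_on hab ?_ (hcont.intervalIntegrable _ _)
          fun x hx => sub_sum_max_le_infDist_sq hα σ hx
        exact (continuous_const.sub
          (continuous_finsetSum _ fun y _ => hbump y)).intervalIntegrable _ _

/-- A lower bound for the weighted quantization error on an interval where the cube root `g` of
the weight oscillates by at most `ε`. -/
lemma le_sq_mul_integral_of_oscillation_le {g : ℝ → ℝ} (hg : Continuous g) (hg0 : ∀ x, 0 ≤ g x)
    {α : Finset ℝ} (hα : α.Nonempty) {a b K ε : ℝ} (hab : a ≤ b) (hK : 0 ≤ K)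
    (hosc : ∀ x ∈ Icc a b, ∀ y ∈ Icc a b, g x ≤ g y + ε) {n : ℕ} (hn : 1 ≤ n) :
    K ^ 2 * ((∫ x in a..b, g x) - ε * (b - a)) -
        4 / 3 * K ^ 3 * (((α.filter (· ∈ Ioo a b)).card + 2) / n) ≤
      n ^ 2 * ∫ x in a..b, g x ^ 3 * infDist x (α : Set ℝ) ^ 2 := by
  obtain ⟨x₀, hx₀, hmin⟩ := isCompact_Icc.exists_isMinOn (nonempty_Icc.2 hab) hg.continuousOn
  set m : ℝ := (α.filter (· ∈ Ioo a b)).card + 2 with hm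
  have hm0 : 0 ≤ m := by positivity
  have hn' : (0 : ℝ) < n := by exact_mod_cast hn
  have hcont : Continuous fun x : ℝ => infDist x (α : Set ℝ) ^ 2 :=
    (continuous_infDist_pt _).pow 2
  have hint : ∫ x in a..b, g x ≤ (g x₀ + ε) * (b - a) := by
    calc ∫ x in a..b, g x ≤ ∫ _ in a..b, (g x₀ + ε) :=
          intervalIntegral.integral_mono_on hab (hg.intervalIntegrable _ _) (by simp)
            fun x hx => hosc x hx x₀ hx₀
      _ = _ := by rw [intervalIntegral.integral_const, smul_eq_mul, mul_comm]
  have hlow : g x₀ ^ 3 * ∫ x in a..b, infDist x (α : Set ℝ) ^ 2 ≤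
      ∫ x in a..b, g x ^ 3 * infDist x (α : Set ℝ) ^ 2 := by
    rw [← intervalIntegral.integral_const_mul]
    refine intervalIntegral.integral_mono_on hab ((hcont.const_mul _).intervalIntegrable _ _)
      (((hg.pow 3).mul hcont).intervalIntegrable _ _) fun x hx => ?_
    gcongr
    · exact hg0 _
    · exact hmin hx
  have hK2 : K ^ 2 * ((∫ x in a..b, g x) - ε * (b - a)) ≤ K ^ 2 * (g x₀ * (b - a)) := by
    gcongr; linarith
  rcases (hg0 x₀).eq_or_lt with h0 | h0
  · rw [← h0] at hK2
    have h1 : 0 ≤ ∫ x in a..b, g x ^ 3 * infDist x (α : Set ℝ) ^ 2 := by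
      refine intervalIntegral.integral_nonneg hab fun x _ => ?_
      have := hg0 x
      positivity
    have h2 : 0 ≤ 4 / 3 * K ^ 3 * (m / n) := by positivity
    have h3 : 0 ≤ (n : ℝ) ^ 2 * ∫ x in a..b, g x ^ 3 * infDist x (α : Set ℝ) ^ 2 := by positivity
    linarith
  · have hσ : 0 ≤ K / (n * g x₀) := by positivity
    have key := le_integral_infDist_sq hα hσ hab
    calc _ ≤ K ^ 2 * (g x₀ * (b - a)) - 4 / 3 * K ^ 3 * (m / n) := by linarith
      _ = n ^ 2 * (g x₀ ^ 3 * ((K / (n * g x₀)) ^ 2 * (b - a) -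
            4 / 3 * (K / (n * g x₀)) ^ 3 * m)) := by field_simp
      _ ≤ n ^ 2 * (g x₀ ^ 3 * ∫ x in a..b, infDist x (α : Set ℝ) ^ 2) := by gcongr
      _ ≤ _ := by gcongr

lemma exists_forall_le_sq_mul_integral {g : ℝ → ℝ} (hg : Continuous g) (hg0 : ∀ x, 0 ≤ g x)
    {a b K ε : ℝ} (hab : a ≤ b) (hK : 0 ≤ K) (hε : 0 < ε) :
    ∃ C : ℝ, ∀ α : Finset ℝ, α.Nonempty → ∀ n : ℕ, 1 ≤ n →
      K ^ 2 * ((∫ x in a..b, g x) - ε * (b - a)) -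
          4 / 3 * K ^ 3 * (((α.filter (· ∈ Ioo a b)).card + C) / n) ≤
        n ^ 2 * ∫ x in a..b, g x ^ 3 * infDist x (α : Set ℝ) ^ 2 := by
  obtain ⟨δ, hδ, hu⟩ := Metric.uniformContinuousOn_iff.1
    (isCompact_Icc.uniformContinuousOn_of_continuous hg.continuousOn (s := Icc a b)) ε hε
  have main (k : ℕ) : ∀ c, a ≤ c → c ≤ b → b - c ≤ k * (δ / 2) →
      ∃ C : ℝ, ∀ α : Finset ℝ, α.Nonempty → ∀ n : ℕ, 1 ≤ n →
        K ^ 2 * ((∫ x in c..b, g x) - ε * (b - c)) -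
            4 / 3 * K ^ 3 * (((α.filter (· ∈ Ioo c b)).card + C) / n) ≤
          n ^ 2 * ∫ x in c..b, g x ^ 3 * infDist x (α : Set ℝ) ^ 2 := by
    have hosc {c d : ℝ} (hc : a ≤ c) (hd : d ≤ b) (hcd : d - c ≤ δ / 2) :
        ∀ x ∈ Icc c d, ∀ y ∈ Icc c d, g x ≤ g y + ε := by
      intro x hx y hy
      have := hu x ⟨hc.trans hx.1, hx.2.trans hd⟩ y ⟨hc.trans hy.1, hy.2.trans hd⟩ (by
        rw [Real.dist_eq, abs_lt]; constructor <;> linarith [hx.1, hx.2, hy.1, hy.2])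
      rw [Real.dist_eq] at this
      linarith [(abs_lt.1 this).2]
    induction k with
    | zero =>
      intro c hc hcb h
      refine ⟨2, fun α hα n hn => le_sq_mul_integral_of_oscillation_le hg hg0 hα hcb hK
        (hosc hc le_rfl (le_trans h ?_)) hn⟩
      simp only [Nat.cast_zero, zero_mul]; positivity
    | succ k ih =>
      intro c hc hcb h
      rcases le_or_gt (b - c) (δ / 2) with hs | hs
      · exact ⟨2, fun α hα n hn => le_sq_mul_integral_of_oscillation_le hg hg0 hα hcb hK
          (hosc hc le_rfl hs) hn⟩
      set d := c + δ / 2 with hd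
      have hcd : c ≤ d := by linarith
      have hdb : d ≤ b := by linarith
      obtain ⟨C, hC⟩ := ih d (by linarith) hdb (by push_cast at h; linarith)
      refine ⟨C + 2, fun α hα n hn => ?_⟩
      have h1 := le_sq_mul_integral_of_oscillation_le hg hg0 hα hcd hK
        (hosc hc hdb (by linarith)) hn
      have h2 := hC α hα n hn
      have hcont : Continuous fun x : ℝ => g x ^ 3 * infDist x (α : Set ℝ) ^ 2 :=
        (hg.pow 3).mul ((continuous_infDist_pt _).pow 2)
      have e1 := intervalIntegral.integral_add_adjacent_intervals
        (hg.intervalIntegrable (μ := volume) c d) (hg.intervalIntegrable d b)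
      have e2 := intervalIntegral.integral_add_adjacent_intervals
        (hcont.intervalIntegrable (μ := volume) c d) (hcont.intervalIntegrable d b)
      have hcard : ((α.filter (· ∈ Ioo c d)).card : ℝ) + (α.filter (· ∈ Ioo d b)).card ≤
          (α.filter (· ∈ Ioo c b)).card := by
        rw [← Nat.cast_add, ← Finset.card_union_of_disjoint]
        · gcongr
          intro x
          simp only [Finset.mem_union, Finset.mem_filter, mem_Ioo]
          rintro (⟨hx, h3, h4⟩ | ⟨hx, h3, h4⟩)
          · exact ⟨hx, h3, by linarith⟩
          · exact ⟨hx, by linarith, h4⟩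
        · rw [Finset.disjoint_left]
          simp only [Finset.mem_filter, mem_Ioo]
          rintro x ⟨-, -, h3⟩ ⟨-, h4, -⟩
          linarith
      have h3 : 4 / 3 * K ^ 3 * (((α.filter (· ∈ Ioo c d)).card + 2 : ℝ) / n) +
          4 / 3 * K ^ 3 * (((α.filter (· ∈ Ioo d b)).card + C) / n) ≤
          4 / 3 * K ^ 3 * (((α.filter (· ∈ Ioo c b)).card + (C + 2)) / n) := by
        rw [← mul_add, ← add_div]
        gcongr ?_ * (?_ / _)
        linarith
      rw [← e1, ← e2]
      linarith
  obtain ⟨k, hk⟩ := exists_nat_ge ((b - a) / (δ / 2))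
  exact main k a le_rfl hab (by rwa [div_le_iff₀ (by positivity)] at hk)

lemma ofReal_integral_le_qerr1 {g f : ℝ → ℝ} (hg : Continuous g) (hg0 : ∀ x, 0 ≤ g x)
    (hfm : Measurable f) (hfg : ∀ x, 0 ≤ x → f x = g x ^ 3) (α : Finset ℝ) {M : ℝ} (hM : 0 ≤ M) :
    ENNReal.ofReal (∫ x in (0 : ℝ)..M, g x ^ 3 * infDist x (α : Set ℝ) ^ 2) ≤
      qerr1 (volume.withDensity fun x => ENNReal.ofReal (f x)) 2 α := by
  have hcont : Continuous fun x : ℝ => g x ^ 3 * infDist x (α : Set ℝ) ^ 2 :=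
    (hg.pow 3).mul ((continuous_infDist_pt _).pow 2)
  have hm : Measurable fun x : ℝ => ENNReal.ofReal (qdist1 x α) ^ (2 : ℝ) :=
    ((continuous_infDist_pt _).measurable.ennreal_ofReal).pow_const _
  rw [qerr1, lintegral_withDensity_eq_lintegral_mul _ hfm.ennreal_ofReal hm,
    intervalIntegral.integral_of_le hM, ofReal_integral_eq_lintegral_ofReal
      (hcont.integrableOn_Icc.mono_set Ioc_subset_Icc_self)
      (ae_of_all _ fun x => mul_nonneg (pow_nonneg (hg0 x) 3) (sq_nonneg _))]
  calc _ = ∫⁻ x in Ioc 0 M, ((fun x => ENNReal.ofReal (f x)) *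
          fun x => ENNReal.ofReal (qdist1 x α) ^ (2 : ℝ)) x := by
        refine setLIntegral_congr_fun measurableSet_Ioc fun x hx => ?_
        simp only [Pi.mul_apply]
        rw [hfg x hx.1.le, ENNReal.ofReal_mul (pow_nonneg (hg0 x) 3),
          ENNReal.ofReal_pow infDist_nonneg, ENNReal.rpow_ofNat, qdist1]
    _ ≤ _ := setLIntegral_le_lintegral _ _

/-- If the codebooks `α n` asymptotically put the proportion `h` of their points into `[0, v]`,
then their normalized quadratic error is asymptotically bounded below by a function of `h`. -/
lemma le_of_tendsto_qerr1 {g f : ℝ → ℝ} (hg : Continuous g) (hg0 : ∀ x, 0 ≤ g x)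
    (hgi : IntegrableOn g (Ioi 0)) (hfm : Measurable f) (hfg : ∀ x, 0 ≤ x → f x = g x ^ 3)
    {α : ℕ → Finset ℝ} (hα : ∀ n, 1 ≤ n → (α n).card = n) {v h q K₁ K₂ : ℝ} (hv : 0 ≤ v)
    (hh : Tendsto (fun n : ℕ => (((α n).filter (· ∈ Icc 0 v)).card : ℝ) / n) atTop (𝓝 h))
    (hq : 0 ≤ q) (hK₁ : 0 ≤ K₁) (hK₂ : 0 ≤ K₂) {Q : ℝ≥0∞} (hQ : Q ≤ ENNReal.ofReal q)
    (hlim : Tendsto (fun n : ℕ => (n : ℝ≥0∞) ^ (2 : ℝ) *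
      qerr1 (volume.withDensity fun x => ENNReal.ofReal (f x)) 2 (α n)) atTop (𝓝 Q)) :
    K₁ ^ 2 * (∫ x in (0 : ℝ)..v, g x) + K₂ ^ 2 * (∫ x in Ioi v, g x) -
      4 / 3 * (K₁ ^ 3 * h + K₂ ^ 3 * (1 - h)) ≤ q := by
  have bound {M ε : ℝ} (hM : v ≤ M) (hε : 0 < ε) :
      K₁ ^ 2 * ((∫ x in (0 : ℝ)..v, g x) - ε * (v - 0)) +
        K₂ ^ 2 * ((∫ x in v..M, g x) - ε * (M - v)) -
        4 / 3 * (K₁ ^ 3 * h + K₂ ^ 3 * (1 - h)) ≤ q := by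
    obtain ⟨C₁, h₁⟩ := exists_forall_le_sq_mul_integral hg hg0 hv hK₁ hε
    obtain ⟨C₂, h₂⟩ := exists_forall_le_sq_mul_integral hg hg0 hM hK₂ hε
    set c : ℕ → ℝ := fun n => (((α n).filter (· ∈ Icc 0 v)).card : ℝ) / n
    set ℓ : ℕ → ℝ := fun n => K₁ ^ 2 * ((∫ x in (0 : ℝ)..v, g x) - ε * (v - 0)) +
        K₂ ^ 2 * ((∫ x in v..M, g x) - ε * (M - v)) -
        4 / 3 * (K₁ ^ 3 * (c n + C₁ / n) + K₂ ^ 3 * (1 - c n + C₂ / n)) with hℓ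
    have hℓlim : Tendsto ℓ atTop (𝓝 (K₁ ^ 2 * ((∫ x in (0 : ℝ)..v, g x) - ε * (v - 0)) +
        K₂ ^ 2 * ((∫ x in v..M, g x) - ε * (M - v)) -
        4 / 3 * (K₁ ^ 3 * (h + 0) + K₂ ^ 3 * (1 - h + 0)))) := by
      have t₁ := tendsto_const_div_atTop_nhds_zero_nat C₁
      have t₂ := tendsto_const_div_atTop_nhds_zero_nat C₂
      exact tendsto_const_nhds.sub (((hh.add t₁).const_mul _).add
        (((hh.const_sub 1).add t₂).const_mul _) |>.const_mul _)
    have hle : ∀ᶠ n : ℕ in atTop, ENNReal.ofReal (ℓ n) ≤ (n : ℝ≥0∞) ^ (2 : ℝ) *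
        qerr1 (volume.withDensity fun x => ENNReal.ofReal (f x)) 2 (α n) := by
      filter_upwards [eventually_ge_atTop 1] with n hn
      have hne : (α n).Nonempty := Finset.card_pos.1 (by rw [hα n hn]; omega)
      have hn' : (0 : ℝ) < n := by exact_mod_cast hn
      have hcont : Continuous fun x : ℝ => g x ^ 3 * infDist x (α n : Set ℝ) ^ 2 :=
        (hg.pow 3).mul ((continuous_infDist_pt _).pow 2)
      have hadd := intervalIntegral.integral_add_adjacent_intervals
        (hcont.intervalIntegrable (μ := volume) 0 v) (hcont.intervalIntegrable v M)
      have c₁ : (((α n).filter (· ∈ Ioo 0 v)).card : ℝ) ≤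
          ((α n).filter (· ∈ Icc 0 v)).card := by
        exact Nat.cast_le.2 (Finset.card_le_card
          (Finset.monotone_filter_right _ fun x _ hx => Ioo_subset_Icc_self hx))
      have c₂ : (((α n).filter (· ∈ Icc 0 v)).card : ℝ) +
          ((α n).filter (· ∈ Ioo v M)).card ≤ n := by
        rw [← Nat.cast_add, ← Finset.card_union_of_disjoint]
        · calc _ ≤ ((α n).card : ℝ) := by
                gcongr
                exact Finset.union_subset (Finset.filter_subset _ _) (Finset.filter_subset _ _)
            _ = n := by rw [hα n hn]
        · rw [Finset.disjoint_left]
          simp only [Finset.mem_filter, mem_Icc, mem_Ioo]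
          rintro x ⟨-, -, h3⟩ ⟨-, h4, -⟩
          linarith
      have b₁ : K₁ ^ 3 * ((((α n).filter (· ∈ Ioo 0 v)).card + C₁) / n) ≤
          K₁ ^ 3 * (c n + C₁ / n) := by
        rw [← add_div]
        gcongr
      have b₂ : K₂ ^ 3 * ((((α n).filter (· ∈ Ioo v M)).card + C₂) / n) ≤
          K₂ ^ 3 * (1 - c n + C₂ / n) := by
        rw [← div_self hn'.ne', ← sub_div, ← add_div]
        gcongr
        linarith
      have hreal : ℓ n ≤ n ^ 2 * ∫ x in (0 : ℝ)..M, g x ^ 3 * infDist x (α n : Set ℝ) ^ 2 := by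
        rw [← hadd]
        simp only [hℓ]
        linarith [h₁ (α n) hne n hn, h₂ (α n) hne n hn]
      calc ENNReal.ofReal (ℓ n)
          ≤ ENNReal.ofReal (n ^ 2 * ∫ x in (0 : ℝ)..M, g x ^ 3 * infDist x (α n : Set ℝ) ^ 2) :=
            ENNReal.ofReal_le_ofReal hreal
        _ = (n : ℝ≥0∞) ^ (2 : ℝ) *
            ENNReal.ofReal (∫ x in (0 : ℝ)..M, g x ^ 3 * infDist x (α n : Set ℝ) ^ 2) := by
            rw [ENNReal.ofReal_mul (by positivity), ENNReal.ofReal_pow hn'.le,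
              ENNReal.ofReal_natCast, ENNReal.rpow_ofNat]
        _ ≤ _ := by
            gcongr
            exact ofReal_integral_le_qerr1 hg hg0 hfm hfg _ (hv.trans hM)
    have := (le_of_tendsto_of_tendsto (ENNReal.tendsto_ofReal hℓlim) hlim hle).trans hQ
    simpa using (ENNReal.ofReal_le_ofReal_iff hq).1 this
  have bound' {M : ℝ} (hM : v ≤ M) :
      K₁ ^ 2 * (∫ x in (0 : ℝ)..v, g x) + K₂ ^ 2 * (∫ x in v..M, g x) -
        4 / 3 * (K₁ ^ 3 * h + K₂ ^ 3 * (1 - h)) ≤ q := by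
    have ht : Tendsto (fun ε : ℝ => K₁ ^ 2 * ((∫ x in (0 : ℝ)..v, g x) - ε * (v - 0)) +
        K₂ ^ 2 * ((∫ x in v..M, g x) - ε * (M - v)) -
        4 / 3 * (K₁ ^ 3 * h + K₂ ^ 3 * (1 - h))) (𝓝[>] 0)
        (𝓝 (K₁ ^ 2 * ((∫ x in (0 : ℝ)..v, g x) - 0 * (v - 0)) +
        K₂ ^ 2 * ((∫ x in v..M, g x) - 0 * (M - v)) -
        4 / 3 * (K₁ ^ 3 * h + K₂ ^ 3 * (1 - h)))) :=
      ((by fun_prop : Continuous fun ε : ℝ =>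
        K₁ ^ 2 * ((∫ x in (0 : ℝ)..v, g x) - ε * (v - 0)) +
        K₂ ^ 2 * ((∫ x in v..M, g x) - ε * (M - v)) -
        4 / 3 * (K₁ ^ 3 * h + K₂ ^ 3 * (1 - h))).tendsto 0).mono_left nhdsWithin_le_nhds
    have := le_of_tendsto ht (eventually_mem_nhdsWithin.mono fun ε hε => bound hM hε)
    simpa using this
  have ht := intervalIntegral_tendsto_integral_Ioi v (hgi.mono_set (Ioi_subset_Ioi hv)) tendsto_id
  exact le_of_tendsto (((ht.const_mul (K₂ ^ 2)).const_add _).sub_const _)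
    ((eventually_ge_atTop v).mono fun M hM => bound' hM)

/-- The point masses of an error-minimizing sequence are determined: a proportion `h` of points in
`[0, v]` different from the normalized mass of `g` there makes the error too large. -/
lemma eq_of_tendsto_qerr1 {g f : ℝ → ℝ} (hg : Continuous g) (hg0 : ∀ x, 0 ≤ g x)
    (hgi : IntegrableOn g (Ioi 0)) (hpos : 0 < ∫ x in Ioi 0, g x) (hfm : Measurable f)
    (hfg : ∀ x, 0 ≤ x → f x = g x ^ 3)
    {α : ℕ → Finset ℝ} (hα : ∀ n, 1 ≤ n → (α n).card = n) {v h : ℝ} (hv : 0 ≤ v)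
    (hh : Tendsto (fun n : ℕ => (((α n).filter (· ∈ Icc 0 v)).card : ℝ) / n) atTop (𝓝 h))
    {Q : ℝ≥0∞} (hQ : Q ≤ ENNReal.ofReal ((∫ x in Ioi 0, g x) ^ 3 / 12))
    (hlim : Tendsto (fun n : ℕ => (n : ℝ≥0∞) ^ (2 : ℝ) *
      qerr1 (volume.withDensity fun x => ENNReal.ofReal (f x)) 2 (α n)) atTop (𝓝 Q)) :
    h = (∫ x in (0 : ℝ)..v, g x) / ∫ x in Ioi 0, g x := by
  set C := ∫ x in Ioi 0, g x with hC
  have hsum : (∫ x in (0 : ℝ)..v, g x) + ∫ x in Ioi v, g x = C := by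
    rw [intervalIntegral.integral_of_le hv, hC, ← Ioc_union_Ioi_eq_Ioi hv,
      setIntegral_union (Ioc_disjoint_Ioi le_rfl) measurableSet_Ioi
        (hgi.mono_set Ioc_subset_Ioi_self) (hgi.mono_set (Ioi_subset_Ioi hv))]
  have htail : 0 ≤ ∫ x in Ioi v, g x := setIntegral_nonneg measurableSet_Ioi fun x _ => hg0 x
  have hhead : 0 ≤ ∫ x in (0 : ℝ)..v, g x := intervalIntegral.integral_nonneg hv fun x _ => hg0 x
  set A := (∫ x in (0 : ℝ)..v, g x) / C with hA
  have hAC : ∫ x in (0 : ℝ)..v, g x = A * C := (div_mul_cancel₀ _ hpos.ne').symm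
  have hA0 : 0 ≤ A := by positivity
  have hA1 : A ≤ 1 := (div_le_one hpos).2 (hsum ▸ le_add_of_nonneg_right htail)
  have hh0 : 0 ≤ h := ge_of_tendsto' hh fun n => div_nonneg (Nat.cast_nonneg _) (Nat.cast_nonneg _)
  have hh1 : h ≤ 1 := by
    refine le_of_tendsto hh ((eventually_ge_atTop 1).mono fun n hn => ?_)
    rw [div_le_one (by exact_mod_cast hn)]
    exact_mod_cast (Finset.card_filter_le _ _).trans (hα n hn).le
  set η := (A - h) / 2 with hη
  have key := le_of_tendsto_qerr1 (K₁ := C / 2 * (1 + η)) (K₂ := C / 2) hg hg0 hgi hfm hfg hα hv hh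
    (by positivity) (mul_nonneg (by positivity) (by linarith)) (by positivity) hQ hlim
  rw [hAC, show ∫ x in Ioi v, g x = C - A * C by linarith] at key
  have hred : C ^ 3 * (6 * η * (A - h) + η ^ 2 * (3 * A - 6 * h) - 2 * η ^ 3 * h) ≤ C ^ 3 * 0 := by
    nlinarith
  have := le_of_mul_le_mul_left hred (by positivity)
  have hAη : A = h + 2 * η := by rw [hη]; ring
  have h1 : η ^ 2 * (h * (1 - η)) ≥ 0 := by
    refine mul_nonneg (sq_nonneg _) (mul_nonneg hh0 (by linarith))
  have h2 : η ^ 2 * (1 - h) ≥ 0 := mul_nonneg (sq_nonneg _) (by linarith)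
  have h3 : η ^ 2 * A ≥ 0 := by positivity
  have h4 : η ^ 2 ≤ 0 := by
    rw [show A - h = 2 * η by linarith] at this
    nlinarith
  have : η = 0 := by nlinarith [pow_eq_zero_iff (two_ne_zero) |>.1 (le_antisymm h4 (sq_nonneg η))]
  linarith

lemma J1_two_le : J1 2 ≤ ENNReal.ofReal (1 / 12) := by
  calc J1 2 ≤ ((1 : ℕ) : ℝ≥0∞) ^ (2 : ℝ) *
        enr1 (volume.restrict (Icc (0 : ℝ) 1)) 2 1 ^ (2 : ℝ) := iInf₂_le 1 le_rfl
    _ ≤ (qerr1 (volume.restrict (Icc (0 : ℝ) 1)) 2 {1 / 2} ^ ((1 : ℝ) / 2)) ^ (2 : ℝ) := by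
        simp only [Nat.cast_one, ENNReal.one_rpow, one_mul]
        gcongr
        exact iInf_le_of_le {1 / 2} (iInf₂_le (Finset.singleton_nonempty _) (by simp))
    _ = qerr1 (volume.restrict (Icc (0 : ℝ) 1)) 2 {1 / 2} := by
        rw [← ENNReal.rpow_mul]; norm_num
    _ = ∫⁻ x in Icc (0 : ℝ) 1, ENNReal.ofReal ((x - 1 / 2) ^ 2) := by
        refine lintegral_congr fun x => ?_
        rw [qdist1, Finset.coe_singleton, infDist_singleton, Real.dist_eq, ENNReal.rpow_ofNat,
          ← ENNReal.ofReal_pow (abs_nonneg _), sq_abs]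
    _ = ENNReal.ofReal (∫ x in (0 : ℝ)..1, (x - 1 / 2) ^ 2) := by
        rw [intervalIntegral.integral_of_le zero_le_one, ← integral_Icc_eq_integral_Ioc,
          ofReal_integral_eq_lintegral_ofReal
            ((by fun_prop : Continuous fun x : ℝ => (x - 1 / 2) ^ 2).integrableOn_Icc)
            (ae_of_all _ fun x => sq_nonneg _)]
    _ = ENNReal.ofReal (1 / 12) := by
        rw [intervalIntegral.integral_comp_sub_right (fun x : ℝ => x ^ 2), integral_pow]
        norm_num

lemma gamma71Density_nonneg (x : ℝ) : 0 ≤ gamma71Density x := by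
  unfold gamma71Density; split_ifs <;> positivity

lemma measurable_gamma71Density : Measurable gamma71Density :=
  Measurable.ite measurableSet_Ioi (by fun_prop) measurable_const

lemma gamma71Density_rpow_of_pos {x : ℝ} (hx : 0 < x) (p : ℝ) :
    gamma71Density x ^ p = (1 / 720) ^ p * (x ^ (6 * p) * Real.exp (-(p * x))) := by
  rw [gamma71Density, if_pos hx, Real.mul_rpow (by positivity) (by positivity),
    Real.mul_rpow (by positivity) (by positivity), ← Real.exp_mul, Real.rpow_mul hx.le]
  norm_num [mul_assoc, mul_comm p x]

lemma gamma71Density_rpow_of_nonpos {x p : ℝ} (hx : x ≤ 0) (hp : p ≠ 0) :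
    gamma71Density x ^ p = 0 := by
  rw [gamma71Density, if_neg hx.not_gt, Real.zero_rpow hp]

lemma gamma71Density_rpow_third {x : ℝ} (hx : 0 ≤ x) :
    gamma71Density x ^ ((1 : ℝ) / 3) =
      (1 / 720) ^ ((1 : ℝ) / 3) * (x ^ 2 * Real.exp (-(1 / 3 * x))) := by
  rcases hx.eq_or_lt with rfl | hx
  · simp [gamma71Density]
  · rw [gamma71Density_rpow_of_pos hx]
    norm_num

lemma gamma71Density_rpow_half {x : ℝ} (hx : 0 ≤ x) :
    gamma71Density x ^ ((1 : ℝ) / 2) =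
      (1 / 720) ^ ((1 : ℝ) / 2) * (x ^ 3 * Real.exp (-(1 / 2 * x))) := by
  rcases hx.eq_or_lt with rfl | hx
  · simp [gamma71Density]
  · rw [gamma71Density_rpow_of_pos hx]
    norm_num

lemma Cft_two : Cft 2 = (1 / 720) ^ ((1 : ℝ) / 3) * 54 := by
  have h := Real.integral_rpow_mul_exp_neg_mul_Ioi (a := 3) (r := 1 / 3) (by norm_num) (by norm_num)
  have hG : Real.Gamma 3 = 2 := by
    simp
  rw [Cft, show (1 : ℝ) / (1 + 2) = 1 / 3 by norm_num,
    setIntegral_congr_fun measurableSet_Ioi fun x hx =>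
      gamma71Density_rpow_third (le_of_lt hx), integral_const_mul]
  norm_num [hG] at h
  norm_num [h]

lemma Cft_one : Cft 1 = (1 / 720) ^ ((1 : ℝ) / 2) * 96 := by
  have h := Real.integral_rpow_mul_exp_neg_mul_Ioi (a := 4) (r := 1 / 2) (by norm_num) (by norm_num)
  have hG : Real.Gamma 4 = 6 := by
    simp [Nat.factorial]
  rw [Cft, show (1 : ℝ) / (1 + 1) = 1 / 2 by norm_num,
    setIntegral_congr_fun measurableSet_Ioi fun x hx =>
      gamma71Density_rpow_half (le_of_lt hx), integral_const_mul]
  norm_num [hG] at h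
  norm_num [h]

lemma integral_sq_mul_exp {k : ℝ} (hk : k ≠ 0) :
    ∫ x in (0 : ℝ)..1, x ^ 2 * Real.exp (-(k * x)) =
      2 / k ^ 3 - Real.exp (-k) * (1 / k + 2 / k ^ 2 + 2 / k ^ 3) := by
  have hd (x : ℝ) : HasDerivAt
      (fun x => -(Real.exp (-(k * x)) * (x ^ 2 / k + 2 * x / k ^ 2 + 2 / k ^ 3)))
      (x ^ 2 * Real.exp (-(k * x))) x := by
    have h1 : HasDerivAt (fun x => Real.exp (-(k * x))) (Real.exp (-(k * x)) * -(k * 1)) x :=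
      ((hasDerivAt_id x).const_mul k).neg.exp
    have h2 : HasDerivAt (fun x => x ^ 2 / k + 2 * x / k ^ 2 + 2 / k ^ 3)
        (2 * x / k + 2 * 1 / k ^ 2) x := by
      simpa using (((hasDerivAt_pow 2 x).div_const k).add
        (((hasDerivAt_id x).const_mul 2).div_const (k ^ 2))).add_const (2 / k ^ 3)
    refine (h1.mul h2).neg.congr_deriv ?_
    field_simp
    ring
  rw [intervalIntegral.integral_eq_sub_of_hasDerivAt (fun x _ => hd x)
    ((by fun_prop : Continuous fun x : ℝ => x ^ 2 * Real.exp (-(k * x))).intervalIntegrable _ _)]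
  simp
  ring

lemma integral_cube_mul_exp {k : ℝ} (hk : k ≠ 0) :
    ∫ x in (0 : ℝ)..1, x ^ 3 * Real.exp (-(k * x)) =
      6 / k ^ 4 - Real.exp (-k) * (1 / k + 3 / k ^ 2 + 6 / k ^ 3 + 6 / k ^ 4) := by
  have hd (x : ℝ) : HasDerivAt
      (fun x => -(Real.exp (-(k * x)) *
        (x ^ 3 / k + 3 * x ^ 2 / k ^ 2 + 6 * x / k ^ 3 + 6 / k ^ 4)))
      (x ^ 3 * Real.exp (-(k * x))) x := by
    have h1 : HasDerivAt (fun x => Real.exp (-(k * x))) (Real.exp (-(k * x)) * -(k * 1)) x :=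
      ((hasDerivAt_id x).const_mul k).neg.exp
    have h2 : HasDerivAt (fun x => x ^ 3 / k + 3 * x ^ 2 / k ^ 2 + 6 * x / k ^ 3 + 6 / k ^ 4)
        (3 * x ^ 2 / k + 3 * (2 * x) / k ^ 2 + 6 * 1 / k ^ 3) x := by
      simpa using ((((hasDerivAt_pow 3 x).div_const k).add
        (((hasDerivAt_pow 2 x).const_mul 3).div_const (k ^ 2))).add
        (((hasDerivAt_id x).const_mul 6).div_const (k ^ 3))).add_const (6 / k ^ 4)
    refine (h1.mul h2).neg.congr_deriv ?_
    field_simp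
    ring
  rw [intervalIntegral.integral_eq_sub_of_hasDerivAt (fun x _ => hd x)
    ((by fun_prop : Continuous fun x : ℝ => x ^ 3 * Real.exp (-(k * x))).intervalIntegrable _ _)]
  simp
  ring

lemma dilated_mass_eq :
    (1 / (Cft 2 * (8 / 9))) *
        ∫ x in Icc (0 : ℝ) 1, gamma71Density (x / (8 / 9)) ^ ((1 : ℝ) / 3) =
      1 - 185 / 128 * Real.exp (-(3 / 8)) := by
  have hpt : ∀ x ∈ Ioc (0 : ℝ) 1, gamma71Density (x / (8 / 9)) ^ ((1 : ℝ) / 3) =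
      (1 / 720) ^ ((1 : ℝ) / 3) * (81 / 64) * (x ^ 2 * Real.exp (-(3 / 8 * x))) := by
    intro x hx
    rw [gamma71Density_rpow_third (div_nonneg hx.1.le (by norm_num))]
    ring_nf
  have hc : (0 : ℝ) < (1 / 720) ^ ((1 : ℝ) / 3) := by positivity
  rw [Cft_two, integral_Icc_eq_integral_Ioc, setIntegral_congr_fun measurableSet_Ioc hpt,
    integral_const_mul, ← intervalIntegral.integral_of_le zero_le_one,
    integral_sq_mul_exp (by norm_num)]
  field_simp
  ring

lemma half_power_mass_eq :
    (1 / Cft 1) * ∫ x in Icc (0 : ℝ) 1, gamma71Density x ^ ((1 : ℝ) / 2) =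
      1 - 79 / 48 * Real.exp (-(1 / 2)) := by
  have hc : (0 : ℝ) < (1 / 720) ^ ((1 : ℝ) / 2) := by positivity
  rw [Cft_one, integral_Icc_eq_integral_Ioc,
    setIntegral_congr_fun measurableSet_Ioc fun x hx => gamma71Density_rpow_half (le_of_lt hx.1),
    integral_const_mul, ← intervalIntegral.integral_of_le zero_le_one,
    integral_cube_mul_exp (by norm_num)]
  field_simp
  ring

lemma dilated_mass_ne :
    (1 / (Cft 2 * (8 / 9))) *
        ∫ x in Icc (0 : ℝ) 1, gamma71Density (x / (8 / 9)) ^ ((1 : ℝ) / 3) ≠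
      (1 / Cft 1) * ∫ x in Icc (0 : ℝ) 1, gamma71Density x ^ ((1 : ℝ) / 2) := by
  rw [dilated_mass_eq, half_power_mass_eq]
  intro h
  have hs : Real.exp (-(3 / 8)) = Real.exp (-(1 / 2)) * Real.exp (1 / 8) := by
    rw [← Real.exp_add]; norm_num
  have he : Real.exp (1 / 8) = 632 / 555 := by
    have := Real.exp_pos (-(1 / 2))
    rw [hs] at h
    have : Real.exp (-(1 / 2)) * (Real.exp (1 / 8) - 632 / 555) = 0 := by linarith
    have := (mul_eq_zero.1 this).resolve_left (Real.exp_pos _).ne'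
    linarith
  have h8 : Real.exp (1 / 8) ^ 8 = Real.exp 1 := by
    rw [← Real.exp_nat_mul]; norm_num
  rw [he] at h8
  have := Real.exp_one_lt_d9
  rw [← h8] at this
  norm_num at this

lemma Q1_gamma71Density_le : Q1 gamma71Density 2 ≤ ENNReal.ofReal (Cft 2 ^ 3 / 12) := by
  have hpos : 0 < Cft 2 := by rw [Cft_two]; positivity
  have hint : IntegrableOn (fun x => gamma71Density x ^ ((1 : ℝ) / (1 + 2))) (Ioi 0) :=
    Integrable.of_integral_ne_zero hpos.ne'
  have hL : ∫⁻ x, ENNReal.ofReal (gamma71Density x) ^ ((1 : ℝ) / (1 + 2)) =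
      ENNReal.ofReal (Cft 2) := by
    rw [Cft, ofReal_integral_eq_lintegral_ofReal hint
      (ae_of_all _ fun x => Real.rpow_nonneg (gamma71Density_nonneg x) _),
      ← lintegral_indicator measurableSet_Ioi]
    refine lintegral_congr fun x => ?_
    rw [ENNReal.ofReal_rpow_of_nonneg (gamma71Density_nonneg x) (by norm_num)]
    by_cases hx : x ∈ Ioi (0 : ℝ)
    · rw [indicator_of_mem hx]
    · rw [indicator_of_notMem hx, gamma71Density_rpow_of_nonpos (not_lt.1 hx) (by norm_num),
        ENNReal.ofReal_zero]
  calc Q1 gamma71Density 2 = J1 2 * ENNReal.ofReal (Cft 2) ^ (1 + 2 : ℝ) := by rw [Q1, hL]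
    _ ≤ ENNReal.ofReal (1 / 12) * ENNReal.ofReal (Cft 2) ^ (1 + 2 : ℝ) := by
        gcongr; exact J1_two_le
    _ = ENNReal.ofReal (Cft 2 ^ 3 / 12) := by
        rw [ENNReal.ofReal_rpow_of_nonneg hpos.le (by norm_num),
          ← ENNReal.ofReal_mul (by norm_num)]
        norm_num [div_eq_inv_mul]

lemma ncard_scaleCB_inter_Icc {θ : ℝ} (hθ : 0 < θ) (α : Finset ℝ) (u : ℝ) :
    (((scaleCB θ α : Finset ℝ) : Set ℝ) ∩ Icc 0 u).ncard =
      (α.filter (· ∈ Icc 0 (u / θ))).card := by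
  have : ((scaleCB θ α : Finset ℝ) : Set ℝ) ∩ Icc 0 u =
      (fun a => θ * a) '' (α.filter (· ∈ Icc 0 (u / θ)) : Finset ℝ) := by
    ext x
    simp only [scaleCB, Finset.coe_image, mem_inter_iff, mem_image, Finset.mem_coe,
      Finset.mem_filter, mem_Icc]
    constructor
    · rintro ⟨⟨a, ha, rfl⟩, h1, h2⟩
      exact ⟨a, ⟨ha, nonneg_of_mul_nonneg_right h1 hθ, by rwa [le_div_iff₀' hθ]⟩, rfl⟩
    · rintro ⟨a, ⟨ha, h1, h2⟩, rfl⟩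
      exact ⟨⟨a, ha, rfl⟩, mul_nonneg hθ.le h1, by rwa [le_div_iff₀' hθ] at h2⟩
  rw [this, ncard_image_of_injective _ (mul_right_injective₀ hθ.ne'), ncard_coe_finset]

/-- **Section 5.3: failure of the empirical measure theorem for `Γ(7,1)`.**
With `r = 2`, `s = 1`, `θ* = 8/9`, the empirical-measure identity fails at `u = 1`:
`(1/(C_{f,2} θ*)) ∫_0^1 f(x/θ*)^{1/3} dx ≠ (1/C_{f,1}) ∫_0^1 f(x)^{1/2} dx`;
equivalently `(185/128) e^{-3/8} - (79/48) e^{-1/2} ≠ -511/512`.  Consequently,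
for any asymptotically `L^2`-optimal sequence `(α_n)` of quantizers for `Γ(7,1)`
with `card α_n = n`, the dilated sequence `(θ*·α_n)` does not satisfy the `L^1`
empirical measure theorem. -/
theorem stmt_19 :
    ((1 / (Cft 2 * (8 / 9))) *
        ∫ x in Icc (0 : ℝ) 1, gamma71Density (x / (8 / 9)) ^ ((1 : ℝ) / 3)) ≠
      ((1 / Cft 1) * ∫ x in Icc (0 : ℝ) 1, gamma71Density x ^ ((1 : ℝ) / 2)) ∧
    (185 / 128 : ℝ) * Real.exp (-(3 / 8)) - (79 / 48) * Real.exp (-(1 / 2)) ≠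
      -(511 / 512) ∧
    ∀ (P : Measure ℝ),
      P = volume.withDensity (fun x => ENNReal.ofReal (gamma71Density x)) →
      ∀ α : ℕ → Finset ℝ, (∀ n, 1 ≤ n → (α n).card = n) →
        AsympOptimalSeq1 P gamma71Density 2 α →
        ¬ (∀ u : ℝ, 0 ≤ u →
          Tendsto (fun n : ℕ =>
              ((((scaleCB (8 / 9) (α n) : Finset ℝ) : Set ℝ) ∩ Icc 0 u).ncard : ℝ) / n)
            atTop
            (𝓝 ((1 / Cft 1) * ∫ x in Icc (0 : ℝ) u, gamma71Density x ^ ((1 : ℝ) / 2)))) := by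
  refine ⟨dilated_mass_ne, ?_, ?_⟩
  · have h1 := Real.add_one_le_exp (-(3 / 8))
    have h2 : Real.exp (-(1 / 2)) < 1 := Real.exp_lt_one_iff.2 (by norm_num)
    linarith
  · rintro P rfl α hα ⟨-, hlim⟩ hemp
    set g : ℝ → ℝ := fun x => (1 / 720) ^ ((1 : ℝ) / 3) * (x ^ 2 * Real.exp (-(1 / 3 * x))) with hg
    have hpos : 0 < Cft 2 := by rw [Cft_two]; positivity
    have hgC : ∫ x in Ioi 0, g x = Cft 2 := by
      rw [Cft, show (1 : ℝ) / (1 + 2) = 1 / 3 by norm_num]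
      exact (setIntegral_congr_fun measurableSet_Ioi fun x hx =>
        gamma71Density_rpow_third (le_of_lt hx)).symm
    have hfg (x : ℝ) (hx : 0 ≤ x) : gamma71Density x = g x ^ 3 := by
      simp only [hg]
      rw [← gamma71Density_rpow_third hx, ← Real.rpow_natCast,
        ← Real.rpow_mul (gamma71Density_nonneg x)]
      norm_num
    have hh := hemp 1 zero_le_one
    simp only [ncard_scaleCB_inter_Icc (by norm_num : (0 : ℝ) < 8 / 9)] at hh
    have key := eq_of_tendsto_qerr1 (g := g) (by fun_prop) (fun x => by positivity)
      (Integrable.of_integral_ne_zero (hgC ▸ hpos.ne')) (hgC ▸ hpos) measurable_gamma71Density hfg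
      hα (by norm_num) hh (hgC ▸ Q1_gamma71Density_le) hlim
    refine dilated_mass_ne (Eq.trans ?_ key.symm)
    have hsub := intervalIntegral.integral_comp_div (a := 0) (b := 1) g
      (by norm_num : (8 / 9 : ℝ) ≠ 0)
    rw [hgC, integral_Icc_eq_integral_Ioc, setIntegral_congr_fun measurableSet_Ioc fun x hx =>
        gamma71Density_rpow_third (div_nonneg hx.1.le (by norm_num : (0 : ℝ) ≤ 8 / 9)),
      ← intervalIntegral.integral_of_le zero_le_one]
    change _ * (∫ x in (0 : ℝ)..1, g (x / (8 / 9))) = _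
    rw [hsub, zero_div, smul_eq_mul]
    field_simp
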